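/- Let Σ_A be a topologically mixing one-sided countable topological Markov shift and φ : Σ_A → ℝ a recurrent potential satisfying the Walters condition with P_G(φ) < ∞. Let h : Σ_A → (0,∞) be a positive continuous function and ν a conservative σ-finite Borel measure, finite on every cylinder, such that L_φ h = e^{P_G(φ)} h and L*_φ ν = e^{P_G(φ)} ν, and set m := h dν. Then m is a φ-DLR measure if and only if h is constant ν-almost surely. -/

import Mathlib

open MeasureTheory Filter Topology ENNReal

namespace CMS

/-- A sequence is admissible for the transition matrix `A`. -/
def IsAdm (A : ℕ → ℕ → Bool) (u : ℕ → ℕ) : Prop := ∀ i, A (u i) (u (i + 1)) = true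

/-- The one-sided countable topological Markov shift. -/
abbrev Space (A : ℕ → ℕ → Bool) := {u : ℕ → ℕ // IsAdm A u}

/-- The transition matrix has no row and no column identically zero. -/
def NoDegenerate (A : ℕ → ℕ → Bool) : Prop :=
  (∀ i, ∃ j, A i j = true) ∧ (∀ j, ∃ i, A i j = true)

/-- The shift map. -/
def shift {A : ℕ → ℕ → Bool} (x : Space A) : Space A :=
  ⟨fun i => x.1 (i + 1), fun i => x.2 (i + 1)⟩

/-- Birkhoff (ergodic) sum `φ_n`. -/
noncomputable def birkhoff {A : ℕ → ℕ → Bool} (φ : Space A → ℝ) (n : ℕ) (x : Space A) : ℝ :=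
  ∑ i ∈ Finset.range n, φ (shift^[i] x)

/-- The cylinder set determined by a word. -/
def cyl (A : ℕ → ℕ → Bool) (w : List ℕ) : Set (Space A) :=
  {x | ∀ i : Fin w.length, x.1 i = w.get i}

/-- Concatenation of a finite word with a sequence. -/
def concatSeq (w : List ℕ) (u : ℕ → ℕ) : ℕ → ℕ :=
  fun i => if h : i < w.length then w.get ⟨i, h⟩ else u (i - w.length)

/-- Prepending a single symbol to a sequence. -/
def prependSeq (a : ℕ) (u : ℕ → ℕ) : ℕ → ℕ := fun i => Nat.casesOn i a u

/-- The set of points to which the symbol `a` may be prepended. -/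
def admits (A : ℕ → ℕ → Bool) (a : ℕ) : Set (Space A) := {x | A a (x.1 0) = true}

/-- Prepending a symbol to a point of the shift space (identity if not admissible). -/
noncomputable def prep (A : ℕ → ℕ → Bool) (a : ℕ) (x : Space A) : Space A :=
  if h : A a (x.1 0) = true then
    ⟨prependSeq a x.1, by
      intro i
      cases i with
      | zero => exact h
      | succ j => exact x.2 j⟩
  else x

/-- The measure `ν ⊚ σ`, `ν⊚σ(E) = Σ_a ν(σ(E ∩ [a]))`. -/
noncomputable def circ (A : ℕ → ℕ → Bool) (ν : Measure (Space A)) : Measure (Space A) :=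
  Measure.sum fun a : ℕ => (ν.restrict (admits A a)).map (prep A a)

/-- `ν` is `(φ, l)`-conformal: `dν/d(ν⊚σ) = l⁻¹ e^φ`. -/
def Conformal (A : ℕ → ℕ → Bool) (φ : Space A → ℝ) (l : ℝ) (ν : Measure (Space A)) : Prop :=
  ∀ E : Set (Space A), MeasurableSet E →
    ν E = ∫⁻ x in E, ENNReal.ofReal (l⁻¹ * Real.exp (φ x)) ∂(circ A ν)

/-- The Ruelle transfer operator. -/
noncomputable def ruelle (A : ℕ → ℕ → Bool) (φ f : Space A → ℝ) (x : Space A) : ℝ :=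
  ∑' a : ℕ, if A a (x.1 0) = true then Real.exp (φ (prep A a x)) * f (prep A a x) else 0

/-- The Ruelle operator applied to the constant function 1, valued in `ℝ≥0∞`. -/
noncomputable def ruelleOne (A : ℕ → ℕ → Bool) (φ : Space A → ℝ) (x : Space A) : ℝ≥0∞ :=
  ∑' a : ℕ, if A a (x.1 0) = true then ENNReal.ofReal (Real.exp (φ (prep A a x))) else 0

/-- `L*_φ ν = l ν` : the dual eigenmeasure equation. -/
def DualEigen (A : ℕ → ℕ → Bool) (φ : Space A → ℝ) (l : ℝ) (ν : Measure (Space A)) : Prop :=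
  ∀ f : Space A → ℝ, Integrable f ν →
    ∫ x, ruelle A φ f x ∂ν = l * ∫ x, f x ∂ν

/-- The sub-σ-algebra `σ^{-n} 𝓑`. -/
def shiftSigma (A : ℕ → ℕ → Bool) (n : ℕ) : MeasurableSpace (Space A) :=
  MeasurableSpace.comap (shift^[n]) inferInstance

/-- A sub-σ-algebra `m` is compatible with `ν`: the restriction of `ν` to `m` is σ-finite. -/
def Compatible (A : ℕ → ℕ → Bool) (ν : Measure (Space A))
    (m : MeasurableSpace (Space A)) : Prop :=
  ∃ s : ℕ → Set (Space A), (∀ k, MeasurableSet[m] (s k)) ∧ (∀ k, ν (s k) ≠ ⊤) ∧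
    (⋃ k, s k) = Set.univ

open Classical in
/-- Numerator of the DLR kernel: `e^{φ_n(w σ^n x)} 1{w σ^n x ∈ Σ_A}`. -/
noncomputable def dlrNum (A : ℕ → ℕ → Bool) (φ : Space A → ℝ) (w : List ℕ)
    (x : Space A) : ℝ :=
  if h : IsAdm A (concatSeq w ((shift^[w.length] x).1)) then
    Real.exp (birkhoff φ w.length (⟨concatSeq w ((shift^[w.length] x).1), h⟩ : Space A))
  else 0

/-- Denominator of the DLR kernel: `Σ_{y : σ^n y = σ^n x} e^{φ_n(y)}`. -/
noncomputable def dlrDen (A : ℕ → ℕ → Bool) (φ : Space A → ℝ) (n : ℕ) (x : Space A) : ℝ :=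
  ∑' y : {y : Space A // shift^[n] y = shift^[n] x}, Real.exp (birkhoff φ n y.1)

/-- `ν` is a `φ`-DLR measure. -/
def IsDLR (A : ℕ → ℕ → Bool) (φ : Space A → ℝ) (ν : Measure (Space A)) : Prop :=
  ∀ n : ℕ, 1 ≤ n →
    Compatible A ν (shiftSigma A n) ∧
    ∀ w : List ℕ, w.length = n →
      (ν[Set.indicator (cyl A w) (fun _ => (1 : ℝ))|shiftSigma A n])
        =ᵐ[ν] fun x => dlrNum A φ w x / dlrDen A φ n x

/-- `ν` is non-singular: `ν ∘ σ⁻¹ ∼ ν`. -/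
def NonSingular (A : ℕ → ℕ → Bool) (ν : Measure (Space A)) : Prop :=
  ν.map shift ≪ ν ∧ ν ≪ ν.map shift

/-- Conservative non-singular measure. -/
def Conservative (A : ℕ → ℕ → Bool) (ν : Measure (Space A)) : Prop :=
  NonSingular A ν ∧
    ∀ W : Set (Space A), MeasurableSet W →
      (∀ i j : ℕ, i ≠ j → ν ((shift^[i] ⁻¹' W) ∩ (shift^[j] ⁻¹' W)) = 0) → ν W = 0

/-- The `n`-th variation `Var_n φ`, valued in `ℝ≥0∞`. -/
noncomputable def varn (A : ℕ → ℕ → Bool) (φ : Space A → ℝ) (n : ℕ) : ℝ≥0∞ :=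
  ⨆ (x : Space A) (y : Space A) (_ : ∀ i, i < n → x.1 i = y.1 i),
    ENNReal.ofReal |φ x - φ y|

noncomputable def waltersBound (A : ℕ → ℕ → Bool) (φ : Space A → ℝ) (k : ℕ) : ℝ≥0∞ :=
  ⨆ (n : ℕ) (_ : 1 ≤ n), varn A (birkhoff φ n) (n + k)

/-- The Walters condition. -/
def Walters (A : ℕ → ℕ → Bool) (φ : Space A → ℝ) : Prop :=
  (∀ k, 1 ≤ k → waltersBound A φ k ≠ ⊤) ∧
  Tendsto (waltersBound A φ) atTop (nhds 0)

/-- `φ` is weakly Hölder continuous. -/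
def WeaklyHolder (A : ℕ → ℕ → Bool) (φ : Space A → ℝ) : Prop :=
  ∃ H θ : ℝ, 0 < H ∧ θ ∈ Set.Ioo (0 : ℝ) 1 ∧
    ∀ n : ℕ, 2 ≤ n → varn A φ n ≤ ENNReal.ofReal (H * θ ^ n)

/-- The partition function `Z_n(φ, a)`, valued in `ℝ≥0∞`. -/
noncomputable def Zn (A : ℕ → ℕ → Bool) (φ : Space A → ℝ) (n a : ℕ) : ℝ≥0∞ :=
  ∑' x : {x : Space A // shift^[n] x = x ∧ x.1 0 = a},
    ENNReal.ofReal (Real.exp (birkhoff φ n x.1))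

/-- The partition function `Z*_n(φ, a)` over periodic points whose first return to `[a]` is `n`. -/
noncomputable def Znstar (A : ℕ → ℕ → Bool) (φ : Space A → ℝ) (n a : ℕ) : ℝ≥0∞ :=
  ∑' x : {x : Space A // shift^[n] x = x ∧ x.1 0 = a ∧
      ∀ k, 0 < k → k < n → (shift^[k] x).1 0 ≠ a},
    ENNReal.ofReal (Real.exp (birkhoff φ n x.1))

/-- `P` is the (finite) Gurevich pressure of `φ`. -/
def HasGurevich (A : ℕ → ℕ → Bool) (φ : Space A → ℝ) (P : ℝ) : Prop :=
  ∀ a : ℕ, (cyl A [a]).Nonempty →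
    (∀ n, 1 ≤ n → Zn A φ n a ≠ ⊤) ∧
    Tendsto (fun n : ℕ => Real.log (Zn A φ n a).toReal / n) atTop (nhds P)

/-- `φ` is recurrent (with Gurevich pressure `P`). -/
def Recurrent (A : ℕ → ℕ → Bool) (φ : Space A → ℝ) (P : ℝ) : Prop :=
  ∀ a : ℕ, (cyl A [a]).Nonempty →
    ∑' n : ℕ, ENNReal.ofReal (Real.exp (-((n + 1 : ℕ) : ℝ) * P)) * Zn A φ (n + 1) a = ⊤

/-- `φ` is positive recurrent (with Gurevich pressure `P`). -/
def PosRecurrent (A : ℕ → ℕ → Bool) (φ : Space A → ℝ) (P : ℝ) : Prop :=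
  Recurrent A φ P ∧
  ∀ a : ℕ, (cyl A [a]).Nonempty →
    ∑' n : ℕ, ((n + 1 : ℕ) : ℝ≥0∞) *
      ENNReal.ofReal (Real.exp (-((n + 1 : ℕ) : ℝ) * P)) * Znstar A φ (n + 1) a ≠ ⊤

/-- `φ` is transient (with Gurevich pressure `P`). -/
def Transient (A : ℕ → ℕ → Bool) (φ : Space A → ℝ) (P : ℝ) : Prop :=
  ∀ a : ℕ, (cyl A [a]).Nonempty →
    ∑' n : ℕ, ENNReal.ofReal (Real.exp (-((n + 1 : ℕ) : ℝ) * P)) * Zn A φ (n + 1) a ≠ ⊤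

/-- `Σ_A` is topologically mixing. -/
def TopMixing (A : ℕ → ℕ → Bool) : Prop :=
  ∀ a b : ℕ, ∃ N : ℕ, ∀ n, N < n → ∃ x : Space A, x.1 0 = a ∧ (shift^[n] x).1 0 = b

/-- The big images and preimages (BIP) property. -/
def BIP (A : ℕ → ℕ → Bool) : Prop :=
  ∃ (N : ℕ) (b : Fin N → ℕ), ∀ a : ℕ,
    (∃ i, A (b i) a = true) ∧ (∃ j, A a (b j) = true)

/-- An admissible word. -/
def AdmWord (A : ℕ → ℕ → Bool) (w : List ℕ) : Prop :=
  ∀ (i : ℕ) (h : i + 1 < w.length),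
    A (w.get ⟨i, Nat.lt_of_succ_lt h⟩) (w.get ⟨i + 1, h⟩) = true

/-- The image of `E ⊆ [a̲]` under the cylinder-swapping map `v_{a̲,b̲}`. -/
def swapImage (A : ℕ → ℕ → Bool) (b : List ℕ) (E : Set (Space A)) : Set (Space A) :=
  {y | ∃ x ∈ E, y.1 = concatSeq b ((shift^[b.length] x).1)}

/-- The image of `E` under the prepending map `I_b`. -/
def prepImage (A : ℕ → ℕ → Bool) (b : ℕ) (E : Set (Space A)) : Set (Space A) :=
  {y | ∃ x ∈ E, y.1 = prependSeq b x.1}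

/-- The transition matrix of the renewal shift:
`A(1,1) = A(1,i) = A(i,i-1) = 1` (for `i > 1`), all other entries `0`. -/
def renA : ℕ → ℕ → Bool := fun i j => decide ((i = 1 ∧ 1 ≤ j) ∨ (2 ≤ i ∧ j = i - 1))

/-- The transition matrix of the shift `Σ_{𝓡⁻}`:
`A(i,i+1) = A(i,1) = 1` for `i ≥ 1`, all other entries `0`. -/
def rminusA : ℕ → ℕ → Bool := fun i j => decide (1 ≤ i ∧ (j = i + 1 ∨ j = 1))

/-- The periodic sequence obtained by repeating the word `w`. -/
def perSeq (w : List ℕ) : ℕ → ℕ := fun i => w.getD (i % w.length) 0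

/-- The word `(j, j-1, …, 1, n, n-1, …, j+1)`. -/
def gammaWord (j n : ℕ) : List ℕ :=
  ((List.range j).map (· + 1)).reverse ++ ((List.range (n - j)).map (· + (j + 1))).reverse

/-- The point `x̄ = (1, 2, 3, …)` of `Σ_{𝓡⁻}`. -/
def xbar : Space rminusA := ⟨fun i => i + 1, by intro i; simp [rminusA]⟩

section Words

variable {A : ℕ → ℕ → Bool}

lemma prep_val {a : ℕ} {x : Space A} (ha : A a (x.1 0) = true) :
    (prep A a x).1 = prependSeq a x.1 := by
  simp [prep, ha]

lemma prep_zero {a : ℕ} {x : Space A} (ha : A a (x.1 0) = true) : (prep A a x).1 0 = a := by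
  rw [prep_val ha]; rfl

lemma shift_prep {a : ℕ} {x : Space A} (ha : A a (x.1 0) = true) : shift (prep A a x) = x := by
  apply Subtype.ext
  funext i
  simp only [shift, prep_val ha]
  rfl

lemma adm_zero_shift (x : Space A) : A (x.1 0) ((shift x).1 0) = true := x.2 0

lemma prep_shift (x : Space A) : prep A (x.1 0) (shift x) = x := by
  apply Subtype.ext
  rw [prep_val (adm_zero_shift x)]
  funext i
  cases i <;> rfl

lemma shift_iterate_val (n : ℕ) (x : Space A) (i : ℕ) : (shift^[n] x).1 i = x.1 (i + n) := by
  induction n generalizing x with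
  | zero => rfl
  | succ n ih =>
    rw [Function.iterate_succ_apply, ih]
    change x.1 (i + n + 1) = _
    rw [add_assoc]

lemma measurable_coord (i : ℕ) : Measurable fun x : Space A => x.1 i :=
  (measurable_pi_apply i).comp measurable_subtype_coe

lemma continuous_coord (i : ℕ) : Continuous fun x : Space A => x.1 i :=
  (continuous_apply i).comp continuous_subtype_val

lemma measurable_shift : Measurable (shift : Space A → Space A) :=
  (measurable_pi_iff.2 fun i => measurable_coord (i + 1)).subtype_mk

lemma measurableSet_admits (a : ℕ) : MeasurableSet (admits A a) :=
  measurable_coord 0 (MeasurableSet.of_discrete (s := {j | A a j = true}))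

lemma measurable_prep (a : ℕ) : Measurable (prep A a) := by
  refine measurable_comap_iff.2 (measurable_pi_iff.2 fun i => ?_)
  have hval : (fun x => (Subtype.val ∘ prep A a) x i)
      = fun x : Space A => if A a (x.1 0) = true then prependSeq a x.1 i else x.1 i := by
    funext x
    by_cases ha : A a (x.1 0) = true <;> simp [prep, ha]
  rw [hval]
  refine Measurable.ite (measurableSet_admits a) ?_ (measurable_coord i)
  cases i with
  | zero => exact measurable_const
  | succ j => exact measurable_coord j

lemma measurableSet_cyl (w : List ℕ) : MeasurableSet (cyl A w) := by
  simp only [cyl, Set.ofPred_forall]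
  exact MeasurableSet.iInter fun i => measurable_coord _ (measurableSet_singleton _)

lemma mem_cyl_singleton {a : ℕ} {x : Space A} : x ∈ cyl A [a] ↔ x.1 0 = a := by
  constructor
  · intro hx
    exact hx ⟨0, by simp⟩
  · rintro hx ⟨i, hi⟩
    obtain rfl : i = 0 := by simpa using hi
    exact hx

lemma mem_cyl_cons {a : ℕ} {w : List ℕ} {x : Space A} :
    x ∈ cyl A (a :: w) ↔ x.1 0 = a ∧ shift x ∈ cyl A w := by
  constructor
  · intro hx
    exact ⟨hx ⟨0, by simp⟩, fun i => hx ⟨i + 1, by simp⟩⟩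
  · rintro ⟨h0, h1⟩ ⟨i, hi⟩
    cases i with
    | zero => exact h0
    | succ j => exact h1 ⟨j, by simpa using hi⟩

lemma concatSeq_nil (u : ℕ → ℕ) : concatSeq [] u = u := by
  funext i; simp [concatSeq]

lemma concatSeq_cons (a : ℕ) (w : List ℕ) (u : ℕ → ℕ) :
    concatSeq (a :: w) u = prependSeq a (concatSeq w u) := by
  funext i
  cases i with
  | zero => simp [concatSeq, prependSeq]
  | succ j => simp [concatSeq, prependSeq]

lemma isAdm_concatSeq_cons {a : ℕ} {w : List ℕ} {u : ℕ → ℕ} :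
    IsAdm A (concatSeq (a :: w) u) ↔
      A a (concatSeq w u 0) = true ∧ IsAdm A (concatSeq w u) := by
  rw [concatSeq_cons]
  constructor
  · intro hu
    exact ⟨hu 0, fun i => hu (i + 1)⟩
  · rintro ⟨h0, h1⟩ i
    cases i with
    | zero => exact h0
    | succ j => exact h1 j

lemma concatSeq_zero_congr (w : List ℕ) {u v : ℕ → ℕ} (huv : u 0 = v 0) :
    concatSeq w u 0 = concatSeq w v 0 := by
  cases w with
  | nil => simpa [concatSeq_nil] using huv
  | cons a w => simp [concatSeq_cons, prependSeq]

lemma IsAdm.concatSeq_congr {w : List ℕ} {u v : ℕ → ℕ} (hu : IsAdm A (concatSeq w u))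
    (hv : IsAdm A v) (huv : u 0 = v 0) : IsAdm A (concatSeq w v) := by
  induction w with
  | nil => simpa [concatSeq_nil] using hv
  | cons a w ih =>
    rw [isAdm_concatSeq_cons] at hu ⊢
    exact ⟨concatSeq_zero_congr w huv ▸ hu.1, ih hu.2⟩

/-- Prepending a word to a point, symbol by symbol; meaningful when the result is admissible. -/
noncomputable def prepWord (A : ℕ → ℕ → Bool) : List ℕ → Space A → Space A
  | [], z => z
  | a :: w, z => prep A a (prepWord A w z)

lemma prepWord_val {w : List ℕ} {z : Space A} (hz : IsAdm A (concatSeq w z.1)) :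
    (prepWord A w z).1 = concatSeq w z.1 := by
  induction w with
  | nil => simp [prepWord, concatSeq_nil]
  | cons a w ih =>
    rw [isAdm_concatSeq_cons] at hz
    rw [prepWord, prep_val (by rw [ih hz.2]; exact hz.1), ih hz.2, concatSeq_cons]

lemma measurable_prepWord (w : List ℕ) : Measurable (prepWord A w) := by
  induction w with
  | nil => exact measurable_id
  | cons a w ih => exact (measurable_prep a).comp ih

/-- The initial word of length `n` of a point. -/
def initWord (n : ℕ) (x : Space A) : List ℕ := List.ofFn fun i : Fin n => x.1 i

lemma length_initWord (n : ℕ) (x : Space A) : (initWord n x).length = n := by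
  simp [initWord]

lemma mem_cyl_initWord {n : ℕ} {x y : Space A} :
    y ∈ cyl A (initWord n x) ↔ ∀ i < n, y.1 i = x.1 i := by
  constructor
  · intro hy i hi
    simpa [initWord] using hy ⟨i, by simpa [initWord] using hi⟩
  · rintro hy ⟨i, hi⟩
    simpa [initWord] using hy i (by simpa [initWord] using hi)

lemma concatSeq_initWord_of_lt {n : ℕ} {x : Space A} {u : ℕ → ℕ} {i : ℕ} (hi : i < n) :
    concatSeq (initWord n x) u i = x.1 i := by
  simp [concatSeq, initWord, hi]

lemma concatSeq_initWord_of_le {n : ℕ} {x : Space A} {u : ℕ → ℕ} {i : ℕ} (hi : n ≤ i) :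
    concatSeq (initWord n x) u i = u (i - n) := by
  simp [concatSeq, initWord, hi.not_gt]

lemma concatSeq_initWord_shift (n : ℕ) (x : Space A) :
    concatSeq (initWord n x) (shift^[n] x).1 = x.1 := by
  funext i
  rcases lt_or_ge i n with hi | hi
  · rw [concatSeq_initWord_of_lt hi]
  · rw [concatSeq_initWord_of_le hi, shift_iterate_val, Nat.sub_add_cancel hi]

lemma isAdm_concatSeq_initWord {n : ℕ} {x z : Space A} (hz : z.1 0 = x.1 n) :
    IsAdm A (concatSeq (initWord n x) z.1) := by
  refine IsAdm.concatSeq_congr (u := (shift^[n] x).1) ?_ z.2 ?_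
  · rw [concatSeq_initWord_shift]; exact x.2
  · rw [shift_iterate_val, zero_add, hz]

lemma prepWord_initWord_shift (n : ℕ) (x : Space A) :
    prepWord A (initWord n x) (shift^[n] x) = x := by
  apply Subtype.ext
  rw [prepWord_val, concatSeq_initWord_shift]
  exact isAdm_concatSeq_initWord (by rw [shift_iterate_val, zero_add])

lemma exists_glue {x z : Space A} {n : ℕ} (hz : z.1 0 = x.1 n) :
    ∃ q : Space A, (∀ i ≤ n, q.1 i = x.1 i) ∧ shift^[n] q = z := by
  refine ⟨⟨_, isAdm_concatSeq_initWord hz⟩, fun i hi => ?_, Subtype.ext (funext fun i => ?_)⟩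
  · rcases hi.lt_or_eq with hi | rfl
    · exact concatSeq_initWord_of_lt hi
    · exact (concatSeq_initWord_of_le le_rfl).trans (by rw [Nat.sub_self, hz])
  · rw [shift_iterate_val]
    exact (concatSeq_initWord_of_le (Nat.le_add_left n i)).trans (by rw [Nat.add_sub_cancel])

lemma TopMixing.exists_extension (hmix : TopMixing A) (y : Space A) (k b : ℕ) :
    ∃ N, ∀ n, N < n → ∃ q : Space A, (∀ i ≤ k, q.1 i = y.1 i) ∧ q.1 n = b := by
  obtain ⟨N, hN⟩ := hmix (y.1 k) b
  refine ⟨N + k, fun n hn => ?_⟩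
  obtain ⟨x, hx0, hxn⟩ := hN (n - k) (by omega)
  obtain ⟨q, hq, hqx⟩ := exists_glue hx0
  refine ⟨q, hq, ?_⟩
  rw [← hxn, ← hqx, shift_iterate_val, shift_iterate_val]
  exact congrArg q.1 (by omega)

lemma exists_cyl_subset {U : Set (Space A)} (hU : IsOpen U) {y : Space A} (hy : y ∈ U) :
    ∃ k, ∀ j, k ≤ j → ∀ x : Space A, (∀ i ≤ j, x.1 i = y.1 i) → x ∈ U := by
  obtain ⟨V, hV, rfl⟩ := isOpen_induced_iff.1 hU
  obtain ⟨I, u, hu, hIu⟩ := isOpen_pi_iff.1 hV y.1 hy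
  refine ⟨I.sup id, fun j hj x hx => hIu fun i hi => ?_⟩
  rw [hx i ((Finset.le_sup (f := id) hi).trans hj)]
  exact (hu i hi).2

lemma isOpen_coord_eq (i a : ℕ) : IsOpen {z : Space A | z.1 i = a} :=
  (isOpen_discrete {a}).preimage (continuous_coord i)

lemma continuousOn_prepWord_initWord (n : ℕ) (x : Space A) :
    ContinuousOn (prepWord A (initWord n x)) {z | z.1 0 = x.1 n} := by
  rw [continuousOn_iff_continuous_domRestrict, continuous_induced_rng]
  have hval : Subtype.val ∘ Set.domRestrict {z : Space A | z.1 0 = x.1 n} (prepWord A (initWord n x))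
      = fun z => concatSeq (initWord n x) z.1.1 :=
    funext fun z => prepWord_val (isAdm_concatSeq_initWord z.2)
  rw [hval]
  refine continuous_pi fun i => ?_
  rcases lt_or_ge i n with hi | hi
  · simp only [concatSeq_initWord_of_lt hi]
    exact continuous_const
  · simp only [concatSeq_initWord_of_le hi]
    exact (continuous_coord _).comp continuous_subtype_val

lemma birkhoff_succ (φ : Space A → ℝ) (n : ℕ) (x : Space A) :
    birkhoff φ (n + 1) x = φ x + birkhoff φ n (shift x) := by
  simp only [birkhoff, Finset.sum_range_succ', Function.iterate_succ_apply]
  rw [add_comm]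
  rfl

lemma birkhoff_succ' (φ : Space A → ℝ) (n : ℕ) (x : Space A) :
    birkhoff φ (n + 1) x = birkhoff φ n x + φ (shift^[n] x) := by
  simp only [birkhoff, Finset.sum_range_succ]

end Words

section Weights

variable {A : ℕ → ℕ → Bool} {φ : Space A → ℝ} {ν : Measure (Space A)} {l : ℝ}

/-- The transfer weight `e^{φ(az)} 1{az ∈ Σ_A}`. -/
noncomputable def weight (φ : Space A → ℝ) (a : ℕ) (z : Space A) : ℝ≥0∞ :=
  if A a (z.1 0) = true then ENNReal.ofReal (Real.exp (φ (prep A a z))) else 0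

/-- The transfer weight `e^{φ_n(wz)} 1{wz ∈ Σ_A}` of a word of length `n`. -/
noncomputable def wordWeight (φ : Space A → ℝ) : List ℕ → Space A → ℝ≥0∞
  | [], _ => 1
  | a :: w, z => weight φ a (prepWord A w z) * wordWeight φ w z

lemma weight_ne_zero_iff {a : ℕ} {z : Space A} : weight φ a z ≠ 0 ↔ A a (z.1 0) = true := by
  simp [weight, Real.exp_pos]

lemma measurable_weight (hφ : Measurable φ) (a : ℕ) : Measurable (weight φ a) :=
  Measurable.ite (measurableSet_admits a)
    (Real.measurable_exp.comp (hφ.comp (measurable_prep a))).ennreal_ofReal measurable_const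

lemma measurable_wordWeight (hφ : Measurable φ) (w : List ℕ) : Measurable (wordWeight φ w) := by
  induction w with
  | nil => exact measurable_const
  | cons a w ih => exact ((measurable_weight hφ a).comp (measurable_prepWord w)).mul ih

lemma measurable_weight_mul (hφ : Measurable φ) (a : ℕ) {f : Space A → ℝ≥0∞}
    (hf : Measurable f) : Measurable fun z => weight φ a z * f (prep A a z) :=
  (measurable_weight hφ a).mul (hf.comp (measurable_prep a))

lemma measurable_wordWeight_mul (hφ : Measurable φ) (w : List ℕ) {f : Space A → ℝ≥0∞}
    (hf : Measurable f) : Measurable fun z => wordWeight φ w z * f (prepWord A w z) :=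
  (measurable_wordWeight hφ w).mul (hf.comp (measurable_prepWord w))

lemma wordWeight_of_adm {w : List ℕ} {z : Space A} (hz : IsAdm A (concatSeq w z.1)) :
    wordWeight φ w z = ENNReal.ofReal (Real.exp (birkhoff φ w.length (prepWord A w z))) := by
  induction w with
  | nil => simp [wordWeight, birkhoff]
  | cons a w ih =>
    rw [isAdm_concatSeq_cons] at hz
    have ha : A a ((prepWord A w z).1 0) = true := by rw [prepWord_val hz.2]; exact hz.1
    rw [wordWeight, ih hz.2, weight, if_pos ha, List.length_cons, birkhoff_succ, prepWord,
      shift_prep ha, Real.exp_add, ENNReal.ofReal_mul (Real.exp_pos _).le]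

lemma wordWeight_ne_zero_iff {w : List ℕ} {z : Space A} :
    wordWeight φ w z ≠ 0 ↔ IsAdm A (concatSeq w z.1) := by
  refine ⟨fun hz => ?_, fun hz => by simp [wordWeight_of_adm hz, Real.exp_pos]⟩
  induction w with
  | nil => simpa [concatSeq_nil] using z.2
  | cons a w ih =>
    have hw := ih (right_ne_zero_of_mul hz)
    rw [isAdm_concatSeq_cons]
    refine ⟨?_, hw⟩
    rw [← prepWord_val hw]
    exact weight_ne_zero_iff.1 (left_ne_zero_of_mul hz)

lemma wordWeight_ne_top (w : List ℕ) (z : Space A) : wordWeight φ w z ≠ ⊤ := by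
  by_cases hz : IsAdm A (concatSeq w z.1)
  · rw [wordWeight_of_adm hz]; exact ENNReal.ofReal_ne_top
  · rw [← wordWeight_ne_zero_iff (φ := φ), not_not] at hz
    simp [hz]

lemma wordWeight_shift_eq_dlrNum (w : List ℕ) (x : Space A) :
    wordWeight φ w (shift^[w.length] x) = ENNReal.ofReal (dlrNum A φ w x) := by
  by_cases hz : IsAdm A (concatSeq w (shift^[w.length] x).1)
  · rw [wordWeight_of_adm hz, dlrNum, dif_pos hz]
    congr 3
    exact Subtype.ext (prepWord_val hz)
  · rw [dlrNum, dif_neg hz, ENNReal.ofReal_zero]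
    by_contra hne
    exact hz (wordWeight_ne_zero_iff.1 hne)

lemma dlrNum_nonneg (w : List ℕ) (x : Space A) : 0 ≤ dlrNum A φ w x := by
  unfold dlrNum
  split_ifs
  · exact (Real.exp_pos _).le
  · exact le_rfl

lemma hasSum_ruelle_indicator {a : ℕ} {E : Set (Space A)} (hE : E ⊆ cyl A [a]) (z : Space A) :
    HasSum (fun b : ℕ => if A b (z.1 0) = true then
        Real.exp (φ (prep A b z)) * E.indicator 1 (prep A b z) else 0)
      (weight φ a z * E.indicator 1 (prep A a z)).toReal := by
  have hval : (weight φ a z * E.indicator 1 (prep A a z)).toReal = if A a (z.1 0) = true then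
      Real.exp (φ (prep A a z)) * E.indicator 1 (prep A a z) else 0 := by
    by_cases ha : A a (z.1 0) = true <;> by_cases hz : prep A a z ∈ E <;>
      simp [weight, ha, hz, (Real.exp_pos _).le]
  rw [hval]
  refine hasSum_single a fun b hb => ?_
  split_ifs with hadm
  · rw [Set.indicator_of_notMem, mul_zero]
    intro hmem
    exact hb ((prep_zero hadm).symm.trans (mem_cyl_singleton.1 (hE hmem)))
  · rfl

lemma exists_cyl_singleton_ne_zero (hν : ν ≠ 0) : ∃ b, ν (cyl A [b]) ≠ 0 := by
  by_contra! hall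
  refine hν (Measure.measure_univ_eq_zero.1 (measure_mono_null ?_ (measure_iUnion_null hall)))
  exact fun x _ => Set.mem_iUnion.2 ⟨x.1 0, mem_cyl_singleton.2 rfl⟩

lemma DualEigen.lintegral_weight_indicator (heig : DualEigen A φ l ν) (hφ : Measurable φ)
    (hl : 0 < l) (hcyl : ∀ w : List ℕ, w ≠ [] → ν (cyl A w) ≠ ⊤) {a : ℕ} {E : Set (Space A)}
    (hE : MeasurableSet E) (hEa : E ⊆ cyl A [a]) :
    ∫⁻ z, weight φ a z * E.indicator 1 (prep A a z) ∂ν = ENNReal.ofReal l * ν E := by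
  rcases eq_or_ne ν 0 with rfl | hν
  · simp
  obtain ⟨b, hb⟩ := exists_cyl_singleton_ne_zero hν
  have hbtop : ν (cyl A [b]) ≠ ⊤ := hcyl _ (by simp)
  have hEtop : ν E ≠ ⊤ := ne_top_of_le_ne_top (hcyl [a] (by simp)) (measure_mono hEa)
  have hB := measurableSet_cyl (A := A) [b]
  have hintE : Integrable (E.indicator (1 : Space A → ℝ)) ν :=
    (integrable_indicator_iff hE).2 (integrableOn_const hEtop)
  have hintB : Integrable ((cyl A [b]).indicator (1 : Space A → ℝ)) ν :=
    (integrable_indicator_iff hB).2 (integrableOn_const hbtop)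
  have hmeas : Measurable fun z => weight φ a z * E.indicator 1 (prep A a z) :=
    measurable_weight_mul hφ a (measurable_one.indicator hE)
  have hne : ∀ z, weight φ a z * E.indicator 1 (prep A a z) ≠ ⊤ := by
    intro z
    refine ENNReal.mul_ne_top ?_ ?_
    · unfold weight; split_ifs <;> simp
    · by_cases hz : prep A a z ∈ E <;> simp [hz]
  have hsum : ∀ z, ruelle A φ (E.indicator 1 + (cyl A [b]).indicator 1) z
      = (weight φ a z * E.indicator 1 (prep A a z)).toReal
        + (weight φ b z * (cyl A [b]).indicator 1 (prep A b z)).toReal := by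
    intro z
    rw [← ((hasSum_ruelle_indicator hEa z).add
      (hasSum_ruelle_indicator (φ := φ) (subset_refl (cyl A [b])) z)).tsum_eq, ruelle]
    refine tsum_congr fun c => ?_
    split_ifs <;> simp [mul_add]
  have hpos : 0 < ∫ z, ruelle A φ (E.indicator 1 + (cyl A [b]).indicator 1) z ∂ν := by
    rw [heig _ (hintE.add hintB)]
    refine mul_pos hl ?_
    simp only [Pi.add_apply]
    rw [integral_add hintE hintB, integral_indicator_one hE, integral_indicator_one hB]
    exact add_pos_of_nonneg_of_pos measureReal_nonneg (ENNReal.toReal_pos hb hbtop)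
  have hint : Integrable (fun z => (weight φ a z * E.indicator 1 (prep A a z)).toReal) ν := by
    refine (Integrable.of_integral_ne_zero hpos.ne').mono'
      hmeas.ennreal_toReal.aestronglyMeasurable (Eventually.of_forall fun z => ?_)
    rw [hsum, Real.norm_of_nonneg ENNReal.toReal_nonneg]
    exact le_add_of_nonneg_right ENNReal.toReal_nonneg
  have key := heig _ hintE
  rw [integral_indicator_one hE] at key
  have hruelle : ∀ z, ruelle A φ (E.indicator 1) z
      = (weight φ a z * E.indicator 1 (prep A a z)).toReal := fun z =>
    (hasSum_ruelle_indicator hEa z).tsum_eq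
  simp only [hruelle] at key
  have := congrArg ENNReal.ofReal key
  rw [ofReal_integral_eq_lintegral_ofReal hint (Eventually.of_forall fun _ =>
    ENNReal.toReal_nonneg), ENNReal.ofReal_mul hl.le, ofReal_measureReal hEtop] at this
  simpa only [ENNReal.ofReal_toReal (hne _)] using this

/-- The conformality of `ν` on one-symbol cylinders. -/
lemma DualEigen.smul_restrict_cyl (heig : DualEigen A φ l ν) (hφ : Measurable φ)
    (hl : 0 < l) (hcyl : ∀ w : List ℕ, w ≠ [] → ν (cyl A w) ≠ ⊤) (a : ℕ) :
    ENNReal.ofReal l • ν.restrict (cyl A [a])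
      = (ν.withDensity (weight φ a)).map (prep A a) := by
  ext E hE
  have hE' := hE.inter (measurableSet_cyl (A := A) [a])
  rw [Measure.smul_apply, Measure.restrict_apply hE, smul_eq_mul,
    ← heig.lintegral_weight_indicator hφ hl hcyl hE' Set.inter_subset_right,
    Measure.map_apply (measurable_prep a) hE, withDensity_apply _ (measurable_prep a hE),
    ← lintegral_indicator (measurable_prep a hE)]
  refine lintegral_congr fun z => ?_
  by_cases ha : A a (z.1 0) = true
  · have hz : prep A a z ∈ cyl A [a] := mem_cyl_singleton.2 (prep_zero ha)
    by_cases hzE : prep A a z ∈ E <;> simp [hz, hzE]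
  · have : weight φ a z = 0 := by simp [weight, ha]
    simp [this, Set.indicator]

/-- The standing hypotheses on an eigenmeasure of the Ruelle operator. -/
structure IsEigenmeasure (A : ℕ → ℕ → Bool) (φ : Space A → ℝ) (l : ℝ) (ν : Measure (Space A)) :
    Prop where
  measurable : Measurable φ
  pos : 0 < l
  cyl_ne_top : ∀ w : List ℕ, w ≠ [] → ν (cyl A w) ≠ ⊤
  dual : DualEigen A φ l ν

lemma IsEigenmeasure.lintegral_cyl_singleton (H : IsEigenmeasure A φ l ν) (a : ℕ)
    {f : Space A → ℝ≥0∞} (hf : Measurable f) :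
    ENNReal.ofReal l * ∫⁻ x in cyl A [a], f x ∂ν = ∫⁻ z, weight φ a z * f (prep A a z) ∂ν := by
  have := congrArg (fun μ => ∫⁻ x, f x ∂μ)
    (H.dual.smul_restrict_cyl H.measurable H.pos H.cyl_ne_top a)
  simp only [lintegral_smul_measure, smul_eq_mul] at this
  rw [this, lintegral_map hf (measurable_prep a), lintegral_withDensity_eq_lintegral_mul _
    (measurable_weight H.measurable a) (g := fun z => f (prep A a z))
    (hf.comp (measurable_prep a))]
  rfl

lemma IsEigenmeasure.lintegral_cyl (H : IsEigenmeasure A φ l ν) (w : List ℕ)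
    {f : Space A → ℝ≥0∞} (hf : Measurable f) :
    ENNReal.ofReal l ^ w.length * ∫⁻ x in cyl A w, f x ∂ν
      = ∫⁻ z, wordWeight φ w z * f (prepWord A w z) ∂ν := by
  induction w generalizing f with
  | nil =>
    have : cyl A [] = Set.univ := Set.eq_univ_of_forall fun x i => i.elim0
    simp [this, wordWeight, prepWord]
  | cons a w ih =>
    have hS := measurable_shift (measurableSet_cyl (A := A) w)
    have hset : cyl A (a :: w) = shift ⁻¹' cyl A w ∩ cyl A [a] := by
      ext x
      rw [mem_cyl_cons, Set.mem_inter_iff, mem_cyl_singleton, and_comm]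
      rfl
    rw [List.length_cons, pow_succ, mul_assoc, hset, ← Measure.restrict_restrict hS,
      ← lintegral_indicator hS, H.lintegral_cyl_singleton a (hf.indicator hS)]
    have hcongr : ∫⁻ z, weight φ a z * (shift ⁻¹' cyl A w).indicator f (prep A a z) ∂ν
        = ∫⁻ z in cyl A w, weight φ a z * f (prep A a z) ∂ν := by
      rw [← lintegral_indicator (measurableSet_cyl w)]
      refine lintegral_congr fun z => ?_
      by_cases ha : A a (z.1 0) = true
      · by_cases hz : z ∈ cyl A w <;> simp [Set.indicator, shift_prep ha, hz]
      · simp [weight, ha, Set.indicator]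
    rw [hcongr, ih (measurable_weight_mul H.measurable a hf)]
    refine lintegral_congr fun z => ?_
    rw [wordWeight, prepWord]
    ring

lemma IsEigenmeasure.lintegral_transfer (H : IsEigenmeasure A φ l ν)
    {f : Space A → ℝ≥0∞} (hf : Measurable f) :
    ENNReal.ofReal l * ∫⁻ x, f x ∂ν = ∫⁻ z, ∑' a, weight φ a z * f (prep A a z) ∂ν := by
  have hU : (⋃ a : ℕ, cyl A [a]) = Set.univ :=
    Set.eq_univ_of_forall fun x => Set.mem_iUnion.2 ⟨x.1 0, mem_cyl_singleton.2 rfl⟩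
  have hdisj : Pairwise (Function.onFun Disjoint fun a : ℕ => cyl A [a]) := by
    intro a b hab
    refine Set.disjoint_left.2 fun x hxa hxb => hab ?_
    rw [← mem_cyl_singleton.1 hxa, mem_cyl_singleton.1 hxb]
  rw [← setLIntegral_univ, ← hU, lintegral_iUnion (fun a => measurableSet_cyl [a]) hdisj,
    ← ENNReal.tsum_mul_left, lintegral_tsum fun a =>
      (measurable_weight_mul H.measurable a hf).aemeasurable]
  exact tsum_congr fun a => H.lintegral_cyl_singleton a hf

lemma IsEigenmeasure.ae_prepWord (H : IsEigenmeasure A φ l ν) (w : List ℕ) {p : Space A → Prop}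
    (hp : ∀ᵐ x ∂ν, p x) : ∀ᵐ z ∂ν, IsAdm A (concatSeq w z.1) → p (prepWord A w z) := by
  set N := toMeasurable ν {x | ¬ p x}
  have hN : MeasurableSet N := measurableSet_toMeasurable _ _
  have hN0 : ν N = 0 := by rw [measure_toMeasurable]; exact hp
  have hf : Measurable (N.indicator (1 : Space A → ℝ≥0∞)) := measurable_one.indicator hN
  have hzero := H.lintegral_cyl w hf
  rw [lintegral_indicator_one hN, Measure.restrict_apply hN,
    measure_mono_null Set.inter_subset_left hN0, mul_zero, eq_comm, lintegral_eq_zero_iff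
    (measurable_wordWeight_mul H.measurable w hf)] at hzero
  filter_upwards [hzero] with z hz hadm
  by_contra hnp
  have hmem : prepWord A w z ∈ N := subset_toMeasurable ν _ hnp
  have : wordWeight φ w z = 0 := by simpa [hmem] using hz
  exact wordWeight_ne_zero_iff.2 hadm this

lemma IsEigenmeasure.isOpenPosMeasure (H : IsEigenmeasure A φ l ν) (hmix : TopMixing A)
    (hν : ν ≠ 0) : ν.IsOpenPosMeasure := by
  refine ⟨fun U hU ⟨y, hy⟩ hU0 => ?_⟩
  obtain ⟨b, hb⟩ := exists_cyl_singleton_ne_zero hν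
  obtain ⟨k, hk⟩ := exists_cyl_subset hU hy
  obtain ⟨N, hN⟩ := hmix.exists_extension y k b
  obtain ⟨q, hqy, hqb⟩ := hN (N + k + 1) (by omega)
  have hae : ∀ᵐ x ∂ν, x ∉ U := measure_eq_zero_iff_ae_notMem.1 hU0
  refine hb (measure_mono_null (fun z hz => ?_) (H.ae_prepWord (initWord (N + k + 1) q) hae))
  have hadm := isAdm_concatSeq_initWord (hqb ▸ mem_cyl_singleton.1 hz : z.1 0 = q.1 (N + k + 1))
  intro hcon
  refine hcon hadm (hk k le_rfl _ fun i hi => ?_)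
  rw [prepWord_val hadm, concatSeq_initWord_of_lt (by omega), hqy i hi]

end Weights

section Eigenfunction

variable {A : ℕ → ℕ → Bool} {φ h : Space A → ℝ} {ν : Measure (Space A)} {l : ℝ}

lemma tsum_weight_mul_eigenfunction (hl : 0 < l) (hpos : ∀ x, 0 < h x)
    (heig : ∀ x, ruelle A φ h x = l * h x) (z : Space A) :
    ∑' a, weight φ a z * ENNReal.ofReal (h (prep A a z))
      = ENNReal.ofReal l * ENNReal.ofReal (h z) := by
  have hne : ruelle A φ h z ≠ 0 := by rw [heig]; exact (mul_pos hl (hpos z)).ne'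
  rw [← ENNReal.ofReal_mul hl.le, ← heig, ruelle, ENNReal.ofReal_tsum_of_nonneg]
  · refine tsum_congr fun a => ?_
    unfold weight
    split_ifs
    · rw [ENNReal.ofReal_mul (Real.exp_pos _).le]
    · simp
  · intro a
    split_ifs
    · exact mul_nonneg (Real.exp_pos _).le (hpos _).le
    · exact le_rfl
  · by_contra hns
    exact hne (tsum_eq_zero_of_not_summable hns)

/-- The standing hypotheses on an eigenmeasure and a positive eigenfunction of the Ruelle
operator. -/
structure IsEigenpair (A : ℕ → ℕ → Bool) (φ : Space A → ℝ) (l : ℝ) (h : Space A → ℝ)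
    (ν : Measure (Space A)) : Prop extends IsEigenmeasure A φ l ν where
  measurable_fun : Measurable h
  fun_pos : ∀ x, 0 < h x
  ruelle_eq : ∀ x, ruelle A φ h x = l * h x

lemma IsEigenpair.measurePreserving_shift (H : IsEigenpair A φ l h ν) :
    MeasurePreserving shift (ν.withDensity fun x => ENNReal.ofReal (h x))
      (ν.withDensity fun x => ENNReal.ofReal (h x)) := by
  refine ⟨measurable_shift, ?_⟩
  ext F hF
  have hS := measurable_shift (A := A) hF
  have hl0 : ENNReal.ofReal l ≠ 0 := by simpa using H.pos
  rw [Measure.map_apply measurable_shift hF, withDensity_apply _ hS, withDensity_apply _ hF,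
    ← ENNReal.mul_right_inj hl0 ENNReal.ofReal_ne_top, ← lintegral_indicator hS,
    ← lintegral_indicator hF, H.lintegral_transfer (H.measurable_fun.ennreal_ofReal.indicator hS),
    ← lintegral_const_mul' _ _ ENNReal.ofReal_ne_top]
  refine lintegral_congr fun z => ?_
  have hterm : ∀ a, weight φ a z *
      (shift ⁻¹' F).indicator (fun x => ENNReal.ofReal (h x)) (prep A a z)
      = F.indicator 1 z * (weight φ a z * ENNReal.ofReal (h (prep A a z))) := by
    intro a
    by_cases ha : A a (z.1 0) = true
    · by_cases hz : z ∈ F <;> simp [Set.indicator, shift_prep ha, hz]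
    · simp [weight, ha]
  rw [tsum_congr hterm, ENNReal.tsum_mul_left,
    tsum_weight_mul_eigenfunction H.pos H.fun_pos H.ruelle_eq]
  by_cases hz : z ∈ F <;> simp [hz]

lemma shiftSigma_le (n : ℕ) : shiftSigma A n ≤ (inferInstance : MeasurableSpace (Space A)) :=
  (measurable_shift.iterate n).comap_le

lemma compatible_shiftSigma {μ : Measure (Space A)} [SigmaFinite μ]
    (hμ : MeasurePreserving shift μ μ) (n : ℕ) : Compatible A μ (shiftSigma A n) := by
  refine ⟨fun k => shift^[n] ⁻¹' spanningSets μ k, fun k => ⟨_, measurableSet_spanningSets μ k,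
    rfl⟩, fun k => ?_, ?_⟩
  · rw [(hμ.iterate n).measure_preimage (measurableSet_spanningSets μ k).nullMeasurableSet]
    exact (measure_spanningSets_lt_top μ k).ne
  · rw [← Set.preimage_iUnion, iUnion_spanningSets, Set.preimage_univ]

lemma Compatible.sigmaFinite_trim {μ : Measure (Space A)} {n : ℕ}
    (hμ : Compatible A μ (shiftSigma A n)) : SigmaFinite (μ.trim (shiftSigma_le n)) := by
  obtain ⟨s, hs, hfin, hU⟩ := hμ
  refine ⟨⟨⟨s, fun _ => trivial, fun k => ?_, hU⟩⟩⟩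
  rw [trim_measurableSet_eq _ (hs k)]
  exact (hfin k).lt_top

/-- The conditional probability, with respect to `h dν`, of the initial word `w` given the
remaining sequence `z`. -/
noncomputable def wordDensity (φ : Space A → ℝ) (l : ℝ) (h : Space A → ℝ) (w : List ℕ)
    (z : Space A) : ℝ≥0∞ :=
  wordWeight φ w z * ENNReal.ofReal (h (prepWord A w z))
    / (ENNReal.ofReal l ^ w.length * ENNReal.ofReal (h z))

lemma IsEigenpair.measurable_wordDensity (H : IsEigenpair A φ l h ν) (w : List ℕ) :
    Measurable (wordDensity φ l h w) :=
  (measurable_wordWeight_mul H.measurable w H.measurable_fun.ennreal_ofReal).div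
    (H.measurable_fun.ennreal_ofReal.const_mul _)

lemma IsEigenpair.mul_wordDensity (H : IsEigenpair A φ l h ν) (w : List ℕ) (z : Space A) :
    ENNReal.ofReal l ^ w.length * (ENNReal.ofReal (h z) * wordDensity φ l h w z)
      = wordWeight φ w z * ENNReal.ofReal (h (prepWord A w z)) := by
  rw [wordDensity, ← mul_assoc]
  refine ENNReal.mul_div_cancel (mul_ne_zero (pow_ne_zero _ ?_) ?_)
    (ENNReal.mul_ne_top (ENNReal.pow_ne_top ENNReal.ofReal_ne_top) ENNReal.ofReal_ne_top)
  · simpa using H.pos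
  · simpa using H.fun_pos z

lemma IsEigenpair.wordDensity_ne_top (H : IsEigenpair A φ l h ν) (w : List ℕ) (z : Space A) :
    wordDensity φ l h w z ≠ ⊤ := by
  refine ENNReal.div_ne_top (ENNReal.mul_ne_top (wordWeight_ne_top w z) ENNReal.ofReal_ne_top)
    (mul_ne_zero (pow_ne_zero _ ?_) ?_)
  · simpa using H.pos
  · simpa using H.fun_pos z

lemma IsEigenpair.setLIntegral_wordDensity (H : IsEigenpair A φ l h ν) (w : List ℕ)
    {F : Set (Space A)} (hF : MeasurableSet F) :
    ∫⁻ x in shift^[w.length] ⁻¹' F, wordDensity φ l h w (shift^[w.length] x)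
        ∂(ν.withDensity fun x => ENNReal.ofReal (h x))
      = (ν.withDensity fun x => ENNReal.ofReal (h x)) (cyl A w ∩ shift^[w.length] ⁻¹' F) := by
  have hl0 : ENNReal.ofReal l ^ w.length ≠ 0 := pow_ne_zero _ (by simpa using H.pos)
  have hltop : ENNReal.ofReal l ^ w.length ≠ ⊤ := ENNReal.pow_ne_top ENNReal.ofReal_ne_top
  have hS : MeasurableSet (shift^[w.length] ⁻¹' F) := measurable_shift.iterate _ hF
  have hh := H.measurable_fun.ennreal_ofReal
  rw [(H.measurePreserving_shift.iterate _).setLIntegral_comp_preimage hF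
      (H.measurable_wordDensity w),
    setLIntegral_withDensity_eq_setLIntegral_mul _ hh (H.measurable_wordDensity w) hF,
    withDensity_apply _ ((measurableSet_cyl w).inter hS), Set.inter_comm,
    ← Measure.restrict_restrict hS, ← lintegral_indicator hS,
    ← ENNReal.mul_right_inj hl0 hltop, H.lintegral_cyl w (hh.indicator hS),
    ← lintegral_indicator hF, ← lintegral_const_mul' _ _ hltop]
  refine lintegral_congr fun z => ?_
  by_cases hz : IsAdm A (concatSeq w z.1)
  · have hshift : shift^[w.length] (prepWord A w z) = z := by
      apply Subtype.ext
      funext i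
      rw [shift_iterate_val, prepWord_val hz]
      simp [concatSeq]
    by_cases hzF : z ∈ F
    · simpa [Set.indicator, hshift, hzF] using H.mul_wordDensity w z
    · simp [Set.indicator, hshift, hzF]
  · have hz0 : wordWeight φ w z = 0 := by
      by_contra hne
      exact hz (wordWeight_ne_zero_iff.1 hne)
    simp [wordDensity, hz0, Set.indicator]

lemma IsEigenpair.condExp_cyl (H : IsEigenpair A φ l h ν) [SigmaFinite ν] {w : List ℕ}
    (hfin : (ν.withDensity fun x => ENNReal.ofReal (h x)) (cyl A w) ≠ ⊤) :
    (ν.withDensity fun x => ENNReal.ofReal (h x))[(cyl A w).indicator fun _ => (1 : ℝ)|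
        shiftSigma A w.length]
      =ᵐ[ν.withDensity fun x => ENNReal.ofReal (h x)]
      fun x => (wordDensity φ l h w (shift^[w.length] x)).toReal := by
  set m := ν.withDensity fun x => ENNReal.ofReal (h x)
  have : SigmaFinite m := SigmaFinite.withDensity_ofReal _
  have := (compatible_shiftSigma H.measurePreserving_shift w.length).sigmaFinite_trim
  have hG : Measurable fun x => wordDensity φ l h w (shift^[w.length] x) :=
    (H.measurable_wordDensity w).comp (measurable_shift.iterate _)
  refine (ae_eq_condExp_of_forall_setIntegral_eq (shiftSigma_le w.length)
    ((integrable_indicator_iff (measurableSet_cyl w)).2 (integrableOn_const hfin)) ?_ ?_ ?_).symm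
  · rintro _ ⟨F, hF, rfl⟩ -
    refine integrable_toReal_of_lintegral_ne_top hG.aemeasurable ?_
    rw [H.setLIntegral_wordDensity w hF]
    exact ne_top_of_le_ne_top hfin (measure_mono Set.inter_subset_left)
  · rintro _ ⟨F, hF, rfl⟩ -
    rw [integral_toReal hG.aemeasurable (Eventually.of_forall fun x =>
      (H.wordDensity_ne_top w _).lt_top), H.setLIntegral_wordDensity w hF,
      setIntegral_indicator (measurableSet_cyl w), Set.inter_comm]
    simp [Measure.real, m]
  · refine Measurable.aestronglyMeasurable ?_
    exact (H.measurable_wordDensity w).ennreal_toReal.comp (comap_measurable _)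

/-- The denominator of the DLR kernel as an extended nonnegative function of `σ^n x`. -/
noncomputable def fibreSum (φ : Space A → ℝ) (n : ℕ) (z : Space A) : ℝ≥0∞ :=
  ∑' y : {y : Space A // shift^[n] y = z}, ENNReal.ofReal (Real.exp (birkhoff φ n y.1))

lemma dlrDen_eq_fibreSum (n : ℕ) (x : Space A) :
    dlrDen A φ n x = (fibreSum φ n (shift^[n] x)).toReal := by
  rw [fibreSum, ENNReal.tsum_toReal_eq fun _ => ENNReal.ofReal_ne_top, dlrDen]
  exact tsum_congr fun y => (ENNReal.toReal_ofReal (Real.exp_pos _).le).symm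

/-- Points of the fibre of the shift correspond to admissible symbols. -/
noncomputable def shiftFibreEquiv (z : Space A) :
    {u : Space A // shift u = z} ≃ {a : ℕ // A a (z.1 0) = true} where
  toFun u := ⟨u.1.1 0, by obtain ⟨u, rfl⟩ := u; exact adm_zero_shift u⟩
  invFun a := ⟨prep A a z, shift_prep a.2⟩
  left_inv := by rintro ⟨u, rfl⟩; exact Subtype.ext (prep_shift u)
  right_inv a := Subtype.ext (prep_zero a.2)

/-- Decomposition of the fibres of `σ^{n+1}` over the fibres of `σ`. -/
def fibreSuccEquiv (n : ℕ) (z : Space A) :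
    {y : Space A // shift^[n + 1] y = z}
      ≃ Σ u : {u : Space A // shift u = z}, {y : Space A // shift^[n] y = u.1} where
  toFun y := ⟨⟨shift^[n] y.1, by rw [← Function.iterate_succ_apply' shift]; exact y.2⟩, y.1, rfl⟩
  invFun p := ⟨p.2.1, by rw [Function.iterate_succ_apply', p.2.2]; exact p.1.2⟩
  left_inv _ := rfl
  right_inv := by rintro ⟨⟨u, hu⟩, y, hy⟩; obtain rfl : shift^[n] y = u := hy; rfl

lemma fibreSum_succ (n : ℕ) (z : Space A) :
    fibreSum φ (n + 1) z = ∑' a, weight φ a z * fibreSum φ n (prep A a z) := by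
  have hfib : ∀ u : {u : Space A // shift u = z}, ∑' y : {y : Space A // shift^[n] y = u.1},
      ENNReal.ofReal (Real.exp (birkhoff φ (n + 1) y.1))
      = ENNReal.ofReal (Real.exp (φ u.1)) * fibreSum φ n u.1 := by
    intro u
    rw [fibreSum, ← ENNReal.tsum_mul_left]
    refine tsum_congr fun y => ?_
    rw [birkhoff_succ', y.2, add_comm, Real.exp_add, ENNReal.ofReal_mul (Real.exp_pos _).le]
  rw [fibreSum, ← (fibreSuccEquiv n z).symm.tsum_eq, ENNReal.tsum_sigma']
  refine (tsum_congr hfib).trans ?_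
  rw [← (shiftFibreEquiv z).symm.tsum_eq]
  have hsub := tsum_subtype {a : ℕ | A a (z.1 0) = true} fun a =>
    ENNReal.ofReal (Real.exp (φ (prep A a z))) * fibreSum φ n (prep A a z)
  refine hsub.trans (tsum_congr fun a => ?_)
  by_cases ha : A a (z.1 0) = true <;> simp [weight, ha]

lemma IsEigenpair.ae_fibreSum (H : IsEigenpair A φ l h ν) {c : ℝ} (hc : ∀ᵐ x ∂ν, h x = c)
    (n : ℕ) : ∀ᵐ z ∂ν, fibreSum φ n z = ENNReal.ofReal l ^ n := by
  have hprep : ∀ {p : Space A → Prop}, (∀ᵐ x ∂ν, p x) →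
      ∀ᵐ z ∂ν, ∀ a, A a (z.1 0) = true → p (prep A a z) := by
    intro p hp
    refine ae_all_iff.2 fun a => ?_
    filter_upwards [H.ae_prepWord [a] hp] with z hz ha
    refine hz (isAdm_concatSeq_cons.2 ?_)
    rw [concatSeq_nil]
    exact ⟨ha, z.2⟩
  have hweight : ∀ᵐ z ∂ν, ∑' a, weight φ a z = ENNReal.ofReal l := by
    filter_upwards [hc, hprep hc] with z hz hza
    have hc0 : ENNReal.ofReal c ≠ 0 := by simpa [hz] using H.fun_pos z
    rw [← ENNReal.mul_left_inj hc0 ENNReal.ofReal_ne_top, ← ENNReal.tsum_mul_right, ← hz,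
      ← tsum_weight_mul_eigenfunction H.pos H.fun_pos H.ruelle_eq]
    refine tsum_congr fun a => ?_
    by_cases ha : A a (z.1 0) = true
    · rw [hza a ha, hz]
    · simp [weight, ha]
  induction n with
  | zero =>
    refine Eventually.of_forall fun z => ?_
    rw [fibreSum, tsum_eq_single (⟨z, rfl⟩ : {y : Space A // shift^[0] y = z})
      fun y hy => (hy (Subtype.ext y.2)).elim]
    simp [birkhoff]
  | succ n ih =>
    filter_upwards [hweight, hprep ih] with z hz hza
    rw [fibreSum_succ, pow_succ', ← hz, ← ENNReal.tsum_mul_right]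
    refine tsum_congr fun a => ?_
    by_cases ha : A a (z.1 0) = true
    · rw [hza a ha, hz]
    · simp [weight, ha]

end Eigenfunction

section DLR

variable {A : ℕ → ℕ → Bool} {φ h : Space A → ℝ} {ν : Measure (Space A)} {l : ℝ}

lemma IsEigenpair.ae_withDensity (H : IsEigenpair A φ l h ν) {p : Space A → Prop} :
    (∀ᵐ x ∂(ν.withDensity fun x => ENNReal.ofReal (h x)), p x) ↔ ∀ᵐ x ∂ν, p x := by
  rw [ae_withDensity_iff H.measurable_fun.ennreal_ofReal]
  simp [H.fun_pos]

lemma toReal_wordWeight_shift (w : List ℕ) (x : Space A) :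
    (wordWeight φ w (shift^[w.length] x)).toReal = dlrNum A φ w x := by
  rw [wordWeight_shift_eq_dlrNum, ENNReal.toReal_ofReal (dlrNum_nonneg w x)]

lemma IsEigenpair.isDLR_of_ae_eq_const (H : IsEigenpair A φ l h ν) [SigmaFinite ν] {c : ℝ}
    (hc : ∀ᵐ x ∂ν, h x = c) : IsDLR A φ (ν.withDensity fun x => ENNReal.ofReal (h x)) := by
  have : SigmaFinite (ν.withDensity fun x => ENNReal.ofReal (h x)) :=
    SigmaFinite.withDensity_ofReal _
  refine fun n hn => ⟨compatible_shiftSigma H.measurePreserving_shift n, ?_⟩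
  rintro w rfl
  have hfin : (ν.withDensity fun x => ENNReal.ofReal (h x)) (cyl A w) ≠ ⊤ := by
    have hcongr : (fun x => ENNReal.ofReal (h x)) =ᵐ[ν.restrict (cyl A w)]
        fun _ => ENNReal.ofReal c := by
      filter_upwards [ae_restrict_of_ae hc] with x hx using by rw [hx]
    rw [withDensity_apply _ (measurableSet_cyl w), lintegral_congr_ae hcongr, setLIntegral_const]
    exact ENNReal.mul_ne_top ENNReal.ofReal_ne_top
      (H.cyl_ne_top w (List.ne_nil_of_length_pos hn))
  refine (H.condExp_cyl hfin).trans ?_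
  have hae : ∀ᵐ z ∂ν, wordDensity φ l h w z = wordWeight φ w z / fibreSum φ w.length z := by
    filter_upwards [hc, H.ae_prepWord w hc, H.ae_fibreSum hc w.length] with z hz hzw hsum
    have hc0 : ENNReal.ofReal c ≠ 0 := by simpa [hz] using H.fun_pos z
    rw [wordDensity, hsum, hz]
    by_cases hadm : IsAdm A (concatSeq w z.1)
    · rw [hzw hadm, ENNReal.mul_div_mul_right _ _ hc0 ENNReal.ofReal_ne_top]
    · have hz0 : wordWeight φ w z = 0 := by
        by_contra hne
        exact hadm (wordWeight_ne_zero_iff.1 hne)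
      simp [hz0]
  filter_upwards [(H.measurePreserving_shift.iterate w.length).quasiMeasurePreserving.ae
    (H.ae_withDensity.2 hae)] with x hx
  rw [hx, ENNReal.toReal_div, toReal_wordWeight_shift, dlrDen_eq_fibreSum]

lemma IsEigenpair.withDensity_cyl_ne_top (H : IsEigenpair A φ l h ν) {w : List ℕ} (hw : w ≠ [])
    {K : ℝ} (hK : ∀ x ∈ cyl A w, h x ≤ K) :
    (ν.withDensity fun x => ENNReal.ofReal (h x)) (cyl A w) ≠ ⊤ := by
  rw [withDensity_apply _ (measurableSet_cyl w)]
  refine ne_top_of_le_ne_top ?_ (setLIntegral_mono (g := fun _ => ENNReal.ofReal K)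
    measurable_const fun x hx => ENNReal.ofReal_le_ofReal (hK x hx))
  rw [setLIntegral_const]
  exact ENNReal.mul_ne_top ENNReal.ofReal_ne_top (H.cyl_ne_top w hw)

lemma IsEigenpair.ae_prepWord_eq_of_isDLR (H : IsEigenpair A φ l h ν) [SigmaFinite ν]
    (hDLR : IsDLR A φ (ν.withDensity fun x => ENNReal.ofReal (h x))) {w v : List ℕ}
    (hw : w ≠ []) (hlen : v.length = w.length)
    (hfinw : (ν.withDensity fun x => ENNReal.ofReal (h x)) (cyl A w) ≠ ⊤)
    (hfinv : (ν.withDensity fun x => ENNReal.ofReal (h x)) (cyl A v) ≠ ⊤) :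
    ∀ᵐ z ∂ν, IsAdm A (concatSeq w z.1) → IsAdm A (concatSeq v z.1) →
      h (prepWord A w z) = h (prepWord A v z) := by
  have hw1 : 1 ≤ w.length := List.length_pos_iff.2 hw
  have hDw := (hDLR w.length hw1).2 w rfl
  have hDv := (hDLR w.length hw1).2 v hlen
  have hcv := H.condExp_cyl hfinv
  rw [hlen] at hcv
  have hx : ∀ᵐ x ∂(ν.withDensity fun x => ENNReal.ofReal (h x)),
      wordDensity φ l h w (shift^[w.length] x) * wordWeight φ v (shift^[w.length] x)
        = wordDensity φ l h v (shift^[w.length] x) * wordWeight φ w (shift^[w.length] x) := by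
    filter_upwards [hDw, hDv, H.condExp_cyl hfinw, hcv] with x h1 h2 h3 h4
    rw [← ENNReal.toReal_eq_toReal_iff'
      (ENNReal.mul_ne_top (H.wordDensity_ne_top _ _) (wordWeight_ne_top _ _))
      (ENNReal.mul_ne_top (H.wordDensity_ne_top _ _) (wordWeight_ne_top _ _)),
      ENNReal.toReal_mul, ENNReal.toReal_mul, ← h3, ← h4, h1, h2, toReal_wordWeight_shift,
      ← hlen, toReal_wordWeight_shift]
    ring
  have hset : MeasurableSet {z | wordDensity φ l h w z * wordWeight φ v z
      = wordDensity φ l h v z * wordWeight φ w z} :=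
    measurableSet_eq_fun
      ((H.measurable_wordDensity w).mul (measurable_wordWeight H.measurable v))
      ((H.measurable_wordDensity v).mul (measurable_wordWeight H.measurable w))
  have hpres := H.measurePreserving_shift.iterate w.length
  have hz := (ae_map_iff hpres.measurable.aemeasurable hset).2 hx
  rw [hpres.map_eq, H.ae_withDensity] at hz
  filter_upwards [hz] with z hz hadmw hadmv
  have h1 := H.mul_wordDensity w z
  have h2 := H.mul_wordDensity v z
  rw [hlen] at h2
  have h3 : wordWeight φ w z * wordWeight φ v z * ENNReal.ofReal (h (prepWord A w z))
      = wordWeight φ w z * wordWeight φ v z * ENNReal.ofReal (h (prepWord A v z)) := by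
    calc _ = (wordWeight φ w z * ENNReal.ofReal (h (prepWord A w z))) * wordWeight φ v z := by ring
      _ = ENNReal.ofReal l ^ w.length * ENNReal.ofReal (h z)
          * (wordDensity φ l h w z * wordWeight φ v z) := by rw [← h1]; ring
      _ = (wordWeight φ v z * ENNReal.ofReal (h (prepWord A v z))) * wordWeight φ w z := by
        rw [hz, ← h2]; ring
      _ = _ := by ring
  rwa [ENNReal.mul_right_inj (mul_ne_zero (wordWeight_ne_zero_iff.2 hadmw)
    (wordWeight_ne_zero_iff.2 hadmv)) (ENNReal.mul_ne_top (wordWeight_ne_top _ _)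
    (wordWeight_ne_top _ _)), ENNReal.ofReal_eq_ofReal_iff (H.fun_pos _).le (H.fun_pos _).le]
    at h3

lemma IsEigenpair.eq_of_shift_iterate_eq (H : IsEigenpair A φ l h ν) [SigmaFinite ν]
    [ν.IsOpenPosMeasure] (hcont : Continuous h)
    (hDLR : IsDLR A φ (ν.withDensity fun x => ENNReal.ofReal (h x))) {n : ℕ} (hn : 1 ≤ n)
    {p q : Space A} (hqp : shift^[n] q = shift^[n] p)
    (hfinq : (ν.withDensity fun x => ENNReal.ofReal (h x)) (cyl A (initWord n q)) ≠ ⊤)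
    (hfinp : (ν.withDensity fun x => ENNReal.ofReal (h x)) (cyl A (initWord n p)) ≠ ⊤) :
    h q = h p := by
  have hne : initWord n q ≠ [] := List.ne_nil_of_length_pos (by rwa [length_initWord])
  have hlen : (initWord n p).length = (initWord n q).length := by simp only [length_initWord]
  have hpq : p.1 n = q.1 n := by
    have := congrArg (fun x : Space A => x.1 0) hqp
    simpa only [shift_iterate_val, zero_add] using this.symm
  set U : Set (Space A) := {z | z.1 0 = q.1 n}
  have hU : IsOpen U := isOpen_coord_eq 0 _
  have hcontq : ContinuousOn (fun z => h (prepWord A (initWord n q) z)) U :=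
    hcont.comp_continuousOn (continuousOn_prepWord_initWord n q)
  have hcontp : ContinuousOn (fun z => h (prepWord A (initWord n p) z)) U := by
    have := hcont.comp_continuousOn (continuousOn_prepWord_initWord n p)
    rwa [hpq] at this
  have hae : (fun z => h (prepWord A (initWord n q) z)) =ᵐ[ν.restrict U]
      fun z => h (prepWord A (initWord n p) z) := by
    refine (ae_restrict_iff' hU.measurableSet).2 ?_
    filter_upwards [H.ae_prepWord_eq_of_isDLR hDLR hne hlen hfinq hfinp] with z hz hzU
    exact hz (isAdm_concatSeq_initWord hzU) (isAdm_concatSeq_initWord (hpq ▸ hzU))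
  have hmem : shift^[n] q ∈ U := by
    change (shift^[n] q).1 0 = _
    rw [shift_iterate_val, zero_add]
  have key := Measure.eqOn_open_of_ae_eq hae hU hcontq hcontp hmem
  simp only at key
  rwa [prepWord_initWord_shift, hqp, prepWord_initWord_shift] at key

lemma Recurrent.exists_periodic {P : ℝ} (hrec : Recurrent A φ P) (hmix : TopMixing A) :
    ∃ (r : ℕ) (p : Space A), shift^[r + 1] p = p := by
  obtain ⟨N, hN⟩ := hmix 0 0
  obtain ⟨x, hx, -⟩ := hN (N + 1) (Nat.lt_succ_self N)
  by_contra! hnone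
  have hZ : ∀ n, Zn A φ (n + 1) 0 = 0 := by
    intro n
    have : IsEmpty {x : Space A // shift^[n + 1] x = x ∧ x.1 0 = 0} :=
      ⟨fun x => hnone n x.1 x.2.1⟩
    exact tsum_empty
  have := hrec 0 ⟨x, mem_cyl_singleton.2 hx⟩
  simp [hZ] at this

lemma IsEigenpair.ae_eq_of_isDLR (H : IsEigenpair A φ l h ν) [SigmaFinite ν]
    (hmix : TopMixing A) (hcont : Continuous h)
    (hDLR : IsDLR A φ (ν.withDensity fun x => ENNReal.ofReal (h x))) {r : ℕ} {p : Space A}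
    (hp : shift^[r + 1] p = p) : ∀ᵐ x ∂ν, h x = h p := by
  rcases eq_or_ne ν 0 with rfl | hν
  · simp
  have := H.isOpenPosMeasure hmix hν
  refine Eventually.of_forall fun y => ?_
  by_contra hne
  obtain ⟨k, hk⟩ := exists_cyl_subset (U := {x | h x ≠ h p} ∩ {x | h x < h y + 1})
    ((isOpen_ne_fun hcont continuous_const).inter (isOpen_lt hcont continuous_const))
    ⟨hne, lt_add_one (h y)⟩
  obtain ⟨j, hj⟩ := exists_cyl_subset (isOpen_lt hcont (continuous_const (y := h p + 1)))
    (lt_add_one (h p))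
  obtain ⟨N, hN⟩ := hmix.exists_extension y k (p.1 0)
  obtain ⟨M, hM, hpM⟩ : ∃ M, N + k + j + 1 ≤ M ∧ shift^[M] p = p :=
    ⟨(r + 1) * (N + k + j + 1), Nat.le_mul_of_pos_left _ r.succ_pos,
      Function.IsPeriodicPt.mul_const (f := shift) hp _⟩
  obtain ⟨x, hxy, hxM⟩ := hN M (by omega)
  obtain ⟨q, hqx, hqp⟩ := exists_glue (z := p) hxM.symm
  have hqy : ∀ i ≤ k, q.1 i = y.1 i := fun i hi => (hqx i (by omega)).trans (hxy i hi)
  refine (hk k le_rfl q hqy).1 (H.eq_of_shift_iterate_eq hcont hDLR (n := M) (by omega)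
    (hqp.trans hpM.symm) (H.withDensity_cyl_ne_top (K := h y + 1) ?_ fun z hz => ?_)
    (H.withDensity_cyl_ne_top (K := h p + 1) ?_ fun z hz => ?_))
  · exact List.ne_nil_of_length_pos (by rw [length_initWord]; omega)
  · rw [mem_cyl_initWord] at hz
    exact (hk k le_rfl z fun i hi => (hz i (by omega)).trans (hqy i hi)).2.le
  · exact List.ne_nil_of_length_pos (by rw [length_initWord]; omega)
  · rw [mem_cyl_initWord] at hz
    exact le_of_lt (hj j le_rfl z fun i hi => hz i (by omega))

end DLR

theorem statement10 (A : ℕ → ℕ → Bool) (hA : NoDegenerate A) (hmix : TopMixing A)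
    (φ : Space A → ℝ) (hφ : Measurable φ) (hw : Walters A φ)
    (P : ℝ) (hP : HasGurevich A φ P) (hrec : Recurrent A φ P)
    (h : Space A → ℝ) (hcont : Continuous h) (hpos : ∀ x, 0 < h x)
    (ν : Measure (Space A)) (hsf : SigmaFinite ν) (hcons : Conservative A ν)
    (hcyl : ∀ w : List ℕ, w ≠ [] → ν (cyl A w) ≠ ⊤)
    (heigf : ∀ x, ruelle A φ h x = Real.exp P * h x)
    (heigm : DualEigen A φ (Real.exp P) ν) :
    IsDLR A φ (ν.withDensity fun x => ENNReal.ofReal (h x)) ↔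
      ∃ c : ℝ, ∀ᵐ x ∂ν, h x = c := by
  have H : IsEigenpair A φ (Real.exp P) h ν :=
    ⟨⟨hφ, Real.exp_pos P, hcyl, heigm⟩, hcont.measurable, hpos, heigf⟩
  refine ⟨fun hDLR => ?_, fun ⟨c, hc⟩ => H.isDLR_of_ae_eq_const hc⟩
  obtain ⟨r, p, hp⟩ := hrec.exists_periodic hmix
  exact ⟨h p, H.ae_eq_of_isDLR hmix hcont hDLR hp⟩

end CMS
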